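/- Let D ⊆ ℂ be open and f : ℂ × D → ℂ a holomorphic function such that for every w ∈ D the entire function z ↦ f(z,w) is nonconstant. Let a : D → ℂ satisfy f(z,w) ≠ a(w) for all w ∈ D and all z ∈ ℂ. Then the function w ↦ ‖a(w)‖ is lower semicontinuous on D. -/

import Mathlib

open Complex Metric Set Filter Topology

/-- An entire function without zeros has an entire logarithm. -/
theorem Complex.exists_exp_eq {f : ℂ → ℂ} (hf : Differentiable ℂ f)
    (h0 : ∀ z, f z ≠ 0) : ∃ g : ℂ → ℂ, Differentiable ℂ g ∧ ∀ z, exp (g z) = f z := by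
  have hf' : Differentiable ℂ (deriv f) :=
    (hf.contDiff (n := 2)).differentiable_deriv_two
  have hq : Differentiable ℂ fun z => deriv f z / f z := hf'.div hf h0
  obtain ⟨G, hG0, hG⟩ := hq.isExactOn_univ.with_val_at 0 (log (f 0))
  have hG' : ∀ z, HasDerivAt G (deriv f z / f z) z := fun z => hG z (mem_univ z)
  have hderiv : ∀ z, HasDerivAt (fun z => f z * exp (-G z)) 0 z := fun z => by
    refine ((hf z).hasDerivAt.mul (hG' z).neg.cexp).congr_deriv ?_
    field_simp [h0 z]
    ring
  refine ⟨G, fun z => (hG' z).differentiableAt, fun z => ?_⟩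
  have hconst := is_const_of_deriv_eq_zero (fun z => (hderiv z).differentiableAt)
    (fun z => (hderiv z).deriv) z 0
  simp only [hG0, exp_neg, exp_log (h0 0), mul_inv_cancel₀ (h0 0)] at hconst
  exact ((mul_inv_eq_one₀ (exp_ne_zero _)).1 hconst).symm

/-- An entire function omitting the values `1` and `-1` factors through `z ↦ cos (π z)`. -/
theorem Complex.exists_cos_pi_mul_eq {f : ℂ → ℂ} (hf : Differentiable ℂ f)
    (h1 : ∀ z, f z ≠ 1) (h2 : ∀ z, f z ≠ -1) :
    ∃ g : ℂ → ℂ, Differentiable ℂ g ∧ ∀ z, cos (Real.pi * g z) = f z := by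
  obtain ⟨L, hL, hLf⟩ := exists_exp_eq ((hf.pow 2).sub_const 1) fun z h => by
    rcases sq_eq_sq_iff_eq_or_eq_neg.1 ((sub_eq_zero.1 h).trans (one_pow 2).symm) with h | h
    exacts [h1 z h, h2 z h]
  have hsq : ∀ z, exp (L z / 2) ^ 2 = f z ^ 2 - 1 := fun z => by
    rw [← exp_nat_mul]
    simpa [mul_div_cancel₀] using hLf z
  have hprod : ∀ z, (f z + exp (L z / 2)) * (f z - exp (L z / 2)) = 1 := fun z => by
    linear_combination -hsq z
  obtain ⟨φ, hφ, hφf⟩ := exists_exp_eq (hf.add (hL.div_const 2).cexp) fun z =>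
    left_ne_zero_of_mul_eq_one (hprod z)
  refine ⟨fun z => φ z / (Real.pi * I), hφ.div_const _, fun z => ?_⟩
  have hπ : (Real.pi : ℂ) ≠ 0 := ofReal_ne_zero.2 Real.pi_ne_zero
  have harg : (Real.pi : ℂ) * (φ z / (Real.pi * I)) * I = φ z := by
    field_simp
  have hneg : exp (-φ z) = f z - exp (L z / 2) := by
    rw [exp_neg, hφf]
    exact inv_eq_of_mul_eq_one_right (hprod z)
  rw [← cosh_mul_I, harg, cosh, hφf, hneg]
  simp only [Pi.add_apply]
  ring

/-- Every point of the plane is close to a point where `z ↦ cos (π z)` is an integer. -/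
theorem exists_dist_lt_cos_pi_mul_eq_intCast (w : ℂ) :
    ∃ v : ℂ, dist v w < 2 ∧ ∃ n : ℤ, cos (Real.pi * v) = n := by
  have hπ := Real.pi_pos
  set a : ℝ := Real.pi * |w.im|
  have ha0 : 0 ≤ a := by positivity
  set n : ℕ := ⌈Real.cosh a⌉₊
  have hle : Real.cosh a ≤ n := Nat.le_ceil _
  have hlt : (n : ℝ) < Real.cosh a + 1 := Nat.ceil_lt_add_one (Real.cosh_pos a).le
  have ha1 := Real.one_le_cosh a
  have hn1 : (1 : ℝ) ≤ n := ha1.trans hle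
  have hcosh : Real.cosh a + 1 ≤ Real.cosh (a + Real.pi) := by
    rw [Real.cosh_add]
    have hs := mul_nonneg (Real.sinh_nonneg_iff.2 ha0) (Real.sinh_nonneg_iff.2 hπ.le)
    have h2 : 2 ≤ Real.cosh Real.pi := by
      have := Real.add_one_le_exp Real.pi
      have := Real.exp_pos (-Real.pi)
      rw [Real.cosh_eq]
      linarith [Real.pi_gt_three]
    nlinarith
  have hlow : a ≤ Real.arcosh n := by
    rw [← Real.arcosh_cosh ha0]
    exact (Real.arcosh_le_arcosh (by linarith) (by linarith)).2 hle
  have hupp : Real.arcosh n ≤ a + Real.pi := by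
    rw [← Real.arcosh_cosh (x := a + Real.pi) (by linarith)]
    exact (Real.arcosh_le_arcosh (by linarith) (by linarith)).2 (by linarith)
  obtain ⟨y, hy, hyw⟩ : ∃ y : ℝ, Real.cosh (Real.pi * y) = n ∧ |y - w.im| ≤ 1 := by
    have hb : |Real.arcosh n / Real.pi - (|w.im|)| ≤ 1 := by
      rw [abs_le, le_sub_iff_add_le, le_div_iff₀ hπ, sub_le_iff_le_add, div_le_iff₀ hπ]
      constructor <;> linarith
    have hc : Real.cosh (Real.pi * (Real.arcosh n / Real.pi)) = n := by
      rw [mul_div_cancel₀ _ hπ.ne', Real.cosh_arcosh hn1]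
    rcases le_total 0 w.im with h | h
    · exact ⟨_, hc, by rwa [abs_of_nonneg h] at hb⟩
    · refine ⟨-(Real.arcosh n / Real.pi), by rwa [mul_neg, Real.cosh_neg], ?_⟩
      rwa [abs_of_nonpos h, ← abs_neg, neg_sub', neg_neg] at hb
  refine ⟨⟨round w.re, y⟩, ?_, (-1) ^ (round w.re).natAbs * n, ?_⟩
  · have hx := abs_sub_round w.re
    rw [abs_sub_comm] at hx
    rw [dist_eq_norm]
    refine (norm_le_abs_re_add_abs_im _).trans_lt ?_
    simp only [sub_re, sub_im]
    linarith
  · have hdecomp : (Real.pi : ℂ) * ⟨round w.re, y⟩ =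
        ((round w.re : ℤ) : ℂ) * Real.pi + (Real.pi * y : ℝ) * I := by
      apply Complex.ext <;> simp [mul_comm]
    rw [hdecomp, cos_add_mul_I, sin_int_mul_pi, ← ofReal_cosh, hy, ← ofReal_intCast, ← ofReal_mul,
      ← ofReal_cos, Real.cos_int_mul_pi]
    rcases Int.even_or_odd (round w.re) with h | h
    · simp [h.neg_one_zpow, (Int.natAbs_even.2 h).neg_one_pow]
    · simp [h.neg_one_zpow, (Int.natAbs_odd.2 h).neg_one_pow]

/-- A holomorphic function whose derivative on a disk is dominated by the derivative at the centre
covers a disk of definite size. -/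
theorem Complex.ball_subset_range_of_norm_deriv_le {f : ℂ → ℂ} (hf : Differentiable ℂ f)
    {p : ℂ} {t : ℝ} (ht : 0 < t) (hp : deriv f p ≠ 0)
    (hbound : ∀ z ∈ ball p t, ‖deriv f z‖ ≤ 2 * ‖deriv f p‖) :
    ball (f p) (‖deriv f p‖ * t / 24) ⊆ range f := by
  have hd : 0 < ‖deriv f p‖ := norm_pos_iff.2 hp
  have hf' : Differentiable ℂ (deriv f) :=
    (hf.contDiff (n := 2)).differentiable_deriv_two
  have hmaps : MapsTo (deriv f) (ball p t) (closedBall (deriv f p) (3 * ‖deriv f p‖)) :=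
    fun z hz => by
      rw [mem_closedBall, dist_eq_norm]
      linarith [norm_sub_le (deriv f z) (deriv f p), hbound z hz]
  have hschwarz : ∀ z ∈ closedBall p (t / 6), ‖deriv f z - deriv f p‖ ≤ ‖deriv f p‖ / 2 :=
    fun z hz => by
      have hz' : z ∈ ball p t := closedBall_subset_ball (by linarith) hz
      have h := dist_le_div_mul_dist_of_mapsTo_ball hf'.differentiableOn hmaps hz'
      rw [dist_eq_norm] at h
      refine h.trans ?_
      calc 3 * ‖deriv f p‖ / t * dist z p ≤ 3 * ‖deriv f p‖ / t * (t / 6) := by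
            gcongr
            exact hz
        _ = ‖deriv f p‖ / 2 := by
            field_simp
            norm_num
  have hlower : ∀ z ∈ sphere p (t / 6), ‖deriv f p‖ * t / 12 ≤ ‖f z - f p‖ := fun z hz => by
    have hmv := (convex_closedBall p (t / 6)).norm_image_sub_le_of_norm_hasDerivWithin_le
      (f := fun z => f z - deriv f p * z) (f' := fun z => deriv f z - deriv f p)
      (fun x _ => (((hf x).hasDerivAt.sub
        ((hasDerivAt_id x).const_mul (deriv f p))).congr_deriv (by simp)).hasDerivWithinAt)
      hschwarz (mem_closedBall_self (by positivity)) (sphere_subset_closedBall hz)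
    have hzp : ‖z - p‖ = t / 6 := by rwa [← dist_eq_norm]
    have hadd := norm_sub_norm_le (deriv f p * (z - p)) (deriv f p * (z - p) - (f z - f p))
    rw [sub_sub_cancel, norm_mul, hzp] at hadd
    rw [hzp, show f z - deriv f p * z - (f p - deriv f p * p) =
      -(deriv f p * (z - p) - (f z - f p)) by ring, norm_neg] at hmv
    linarith
  have hfreq : ∃ᶠ z in 𝓝 p, f z ≠ f p := fun h => hp <| by
    have : f =ᶠ[𝓝 p] fun _ => f p := h.mono fun z hz => not_not.1 hz
    simpa using this.deriv_eq
  have := hf.diffContOnCl.ball_subset_image_closedBall (by positivity) hlower hfreq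
  refine Subset.trans ?_ (this.trans (image_subset_range _ _))
  exact ball_subset_ball (by linarith)

/-- **Bloch's theorem** for entire functions: the range of a nonconstant entire function contains
disks of arbitrarily large radius. -/
theorem Complex.exists_ball_subset_range {f : ℂ → ℂ} (hf : Differentiable ℂ f) {c : ℂ}
    (hc : deriv f c ≠ 0) {r : ℝ} (hr : 0 < r) : ∃ w, ball w r ⊆ range f := by
  have hd : 0 < ‖deriv f c‖ := norm_pos_iff.2 hc
  have hf' : Continuous (deriv f) :=
    (hf.contDiff (n := 2)).differentiable_deriv_two.continuous
  obtain ⟨R, hR⟩ : ∃ R, R = 48 * r / ‖deriv f c‖ := ⟨_, rfl⟩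
  have hR0 : 0 < R := by rw [hR]; positivity
  have hRr : R * ‖deriv f c‖ = 48 * r := by rw [hR]; field_simp
  obtain ⟨p, hp, hmax⟩ := (isCompact_closedBall c R).exists_isMaxOn
    (f := fun z => (R - dist z c) * ‖deriv f z‖) ⟨c, mem_closedBall_self hR0.le⟩
    (by fun_prop)
  have hmax' : ∀ z ∈ closedBall c R, (R - dist z c) * ‖deriv f z‖ ≤
      (R - dist p c) * ‖deriv f p‖ := fun z hz => hmax hz
  have hcp := hmax' c (mem_closedBall_self hR0.le)
  rw [dist_self, sub_zero, hRr] at hcp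
  have hpos : 0 < (R - dist p c) * ‖deriv f p‖ := by linarith
  have hpR : 0 < R - dist p c := pos_of_mul_pos_left hpos (norm_nonneg _)
  have hp0 : deriv f p ≠ 0 := norm_pos_iff.1 (pos_of_mul_pos_right hpos hpR.le)
  refine ⟨f p, Subset.trans (ball_subset_ball ?_) (ball_subset_range_of_norm_deriv_le hf
    (t := (R - dist p c) / 2) (half_pos hpR) hp0 fun z hz => ?_)⟩
  · linarith
  · have hzp : dist z p < (R - dist p c) / 2 := hz
    have hzc := dist_triangle z p c
    have hm := hmax' z (by rw [mem_closedBall]; linarith)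
    have hh : (R - dist p c) / 2 * ‖deriv f z‖ ≤ (R - dist z c) * ‖deriv f z‖ := by
      gcongr
      linarith
    refine le_of_mul_le_mul_left ?_ (half_pos hpR)
    linarith

/-- **Little Picard theorem**: an entire function omitting two distinct values is constant. -/
theorem Complex.apply_eq_apply_of_forall_ne {f : ℂ → ℂ} (hf : Differentiable ℂ f)
    {a b : ℂ} (hab : a ≠ b) (ha : ∀ z, f z ≠ a) (hb : ∀ z, f z ≠ b) (z₁ z₂ : ℂ) :
    f z₁ = f z₂ := by
  have hba : b - a ≠ 0 := sub_ne_zero.2 hab.symm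
  obtain ⟨F, hF, hFf⟩ := exists_cos_pi_mul_eq
    (((hf.const_mul 2).sub_const (a + b)).div_const (b - a))
    (fun z h => hb z (by rw [div_eq_iff hba] at h; linear_combination h / 2))
    (fun z h => ha z (by rw [div_eq_iff hba] at h; linear_combination h / 2))
  have hFint : ∀ z, ∀ n : ℤ, F z ≠ n := fun z n h => by
    have hcos := hFf z
    rw [h, mul_comm, ← ofReal_intCast, ← ofReal_mul, ← ofReal_cos, Real.cos_int_mul_pi,
      eq_div_iff hba] at hcos
    rcases Int.even_or_odd n with hn | hn
    · rw [hn.neg_one_zpow, ofReal_one] at hcos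
      exact hb z (by linear_combination -hcos / 2)
    · rw [hn.neg_one_zpow, ofReal_neg, ofReal_one] at hcos
      exact ha z (by linear_combination -hcos / 2)
  obtain ⟨g, hg, hgF⟩ := exists_cos_pi_mul_eq hF (fun z => by simpa using hFint z 1)
    (fun z => by simpa using hFint z (-1))
  have hderiv : ∀ z, deriv g z = 0 := fun z => by
    by_contra hz
    obtain ⟨w, hw⟩ := exists_ball_subset_range hg hz two_pos
    obtain ⟨v, hv, n, hn⟩ := exists_dist_lt_cos_pi_mul_eq_intCast w
    obtain ⟨u, rfl⟩ := hw hv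
    exact hFint u n (by rw [← hgF, hn])
  have hgc := is_const_of_deriv_eq_zero hg hderiv z₁ z₂
  have h1 := hFf z₁
  rw [← hgF, hgc, hgF, hFf, div_left_inj' hba] at h1
  linear_combination -h1 / 2

/-- A **Hurwitz theorem** for families: a value attained by a nonconstant member of a holomorphic
family of entire functions is attained, together with all nearby values, by all nearby members. -/
theorem eventually_mem_range_of_analyticOnNhd {D : Set ℂ} (hD : IsOpen D) {f : ℂ × ℂ → ℂ}
    (hf : AnalyticOnNhd ℂ f (univ ×ˢ D)) {w₀ : ℂ} (hw₀ : w₀ ∈ D)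
    (hnc : ∃ z₁ z₂ : ℂ, f (z₁, w₀) ≠ f (z₂, w₀)) (z₀ : ℂ) :
    ∀ᶠ q : ℂ × ℂ in 𝓝 (w₀, f (z₀, w₀)), q.2 ∈ range fun z => f (z, q.1) := by
  have hcont : ∀ z, ∀ w ∈ D, ContinuousAt f (z, w) := fun z w hw =>
    (hf (z, w) ⟨mem_univ z, hw⟩).continuousAt
  have hslice : ∀ w ∈ D, Differentiable ℂ fun z => f (z, w) := fun w hw z =>
    (hf (z, w) ⟨mem_univ z, hw⟩).differentiableAt.comp z
      (differentiableAt_id.prodMk (differentiableAt_const w))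
  have hiso : ∀ᶠ z in 𝓝[≠] z₀, f (z, w₀) ≠ f (z₀, w₀) := by
    by_contra hfr
    have han : AnalyticOnNhd ℂ (fun z => f (z, w₀)) univ :=
      fun z _ => (hslice w₀ hw₀).analyticAt z
    have hfr' : ∃ᶠ z in 𝓝[≠] z₀, f (z, w₀) = f (z₀, w₀) := by
      simpa only [Filter.Frequently] using hfr
    have heq := han.eqOn_of_preconnected_of_frequently_eq analyticOnNhd_const
      isPreconnected_univ (mem_univ z₀) hfr'
    obtain ⟨z₁, z₂, hne⟩ := hnc
    exact hne ((heq (mem_univ z₁)).trans (heq (mem_univ z₂)).symm)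
  obtain ⟨r, hr, hr'⟩ : ∃ r > 0, ∀ z ∈ sphere z₀ r, f (z, w₀) ≠ f (z₀, w₀) := by
    rw [eventually_nhdsWithin_iff, Metric.eventually_nhds_iff] at hiso
    obtain ⟨ε, hε, h⟩ := hiso
    refine ⟨ε / 2, half_pos hε, fun z hz => h ?_ ?_⟩
    · rw [mem_sphere.1 hz]
      linarith
    · exact ne_of_mem_sphere hz (half_pos hε).ne'
  obtain ⟨ε, hε, hsphere⟩ : ∃ ε > 0, ∀ z ∈ sphere z₀ r, ε < ‖f (z, w₀) - f (z₀, w₀)‖ := by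
    obtain ⟨m, hm, hmin⟩ := (isCompact_sphere z₀ r).exists_isMinOn
      (NormedSpace.sphere_nonempty.2 hr.le)
      (f := fun z => ‖f (z, w₀) - f (z₀, w₀)‖)
      ((hslice w₀ hw₀).continuous.sub continuous_const).norm.continuousOn
    have hpos : 0 < ‖f (m, w₀) - f (z₀, w₀)‖ := norm_pos_iff.2 (sub_ne_zero.2 (hr' m hm))
    exact ⟨_, half_pos hpos, fun z hz => (half_lt_self hpos).trans_le (hmin hz)⟩
  have hcenter : ContinuousAt (fun w => f (z₀, w)) w₀ :=
    (hcont z₀ w₀ hw₀).comp (f := fun w => (z₀, w)) (by fun_prop)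
  have hunif : ∀ᶠ w in 𝓝 w₀, ∀ z ∈ sphere z₀ r, ε < ‖f (z, w) - f (z₀, w)‖ := by
    refine (isCompact_sphere z₀ r).eventually_forall_of_forall_eventually fun z hz => ?_
    have h1 : ContinuousAt (fun q : ℂ × ℂ => f (q.2, q.1)) (w₀, z) :=
      (hcont z w₀ hw₀).comp (f := fun q : ℂ × ℂ => (q.2, q.1)) (by fun_prop)
    have h2 : ContinuousAt (fun q : ℂ × ℂ => f (z₀, q.1)) (w₀, z) :=
      ContinuousAt.comp (f := fun q : ℂ × ℂ => q.1) (g := fun w => f (z₀, w)) hcenter continuousAt_fst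
    exact (h1.sub h2).norm.eventually_const_lt (hsphere z hz)
  have hnear : ∀ᶠ q : ℂ × ℂ in 𝓝 (w₀, f (z₀, w₀)), dist q.2 (f (z₀, q.1)) < ε / 2 := by
    have h2 : ContinuousAt (fun q : ℂ × ℂ => f (z₀, q.1)) (w₀, f (z₀, w₀)) :=
      ContinuousAt.comp (f := fun q : ℂ × ℂ => q.1) (g := fun w => f (z₀, w)) hcenter continuousAt_fst
    exact (continuousAt_snd.dist h2).eventually_lt_const (by simpa using half_pos hε)
  filter_upwards [hnear, continuousAt_fst.eventually (hunif.and (hD.mem_nhds hw₀))]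
    with q hq ⟨hq1, hqD⟩
  have hfreq : ∃ᶠ z in 𝓝 z₀, f (z, q.1) ≠ f (z₀, q.1) := fun h => by
    have heq := AnalyticOnNhd.eqOn_of_preconnected_of_eventuallyEq
      (f := fun z => f (z, q.1)) (g := fun _ => f (z₀, q.1)) (U := univ)
      (fun z _ => (hslice q.1 hqD).analyticAt z) analyticOnNhd_const isPreconnected_univ
      (mem_univ z₀) (h.mono fun z hz => not_not.1 hz)
    obtain ⟨z, hz⟩ := NormedSpace.sphere_nonempty (x := z₀).2 hr.le
    have hlt := hq1 z hz
    rw [show f (z, q.1) = f (z₀, q.1) from heq (mem_univ z), sub_self, norm_zero] at hlt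
    exact hε.not_gt hlt
  exact image_subset_range _ _ ((hslice q.1 hqD).diffContOnCl.ball_subset_image_closedBall hr
    (fun z hz => (hq1 z hz).le) hfreq hq)


/-- If `f : ℂ × D → ℂ` is holomorphic, `D ⊆ ℂ` open, all functions `z ↦ f (z, w)`
nonconstant, and `a : D → ℂ` is a selection of exceptional values
(`f (z, w) ≠ a w` for all `z` and all `w ∈ D`), then `w ↦ ‖a w‖` is lower
semicontinuous on `D`. -/
theorem stmt_11
    (D : Set ℂ) (hD : IsOpen D)
    (f : ℂ × ℂ → ℂ)
    (hf : AnalyticOnNhd ℂ f (Set.univ ×ˢ D))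
    (hnc : ∀ w ∈ D, ∃ z₁ z₂ : ℂ, f (z₁, w) ≠ f (z₂, w))
    (a : ℂ → ℂ)
    (ha : ∀ w ∈ D, ∀ z : ℂ, f (z, w) ≠ a w) :
    LowerSemicontinuousOn (fun w => ‖a w‖) D := by
  intro w₀ hw₀ y hy
  have hdiff : Differentiable ℂ fun z => f (z, w₀) := fun z =>
    (hf (z, w₀) ⟨mem_univ z, hw₀⟩).differentiableAt.comp z
      (differentiableAt_id.prodMk (differentiableAt_const w₀))
  have hball : ∀ᶠ w in 𝓝 w₀, ∀ b ∈ closedBall (0 : ℂ) y, b ∈ range fun z => f (z, w) := by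
    refine (isCompact_closedBall 0 y).eventually_forall_of_forall_eventually fun b hb => ?_
    have hne : b ≠ a w₀ := by
      rintro rfl
      exact (mem_closedBall_zero_iff.1 hb).not_gt hy
    obtain ⟨z₀, rfl⟩ : ∃ z₀, f (z₀, w₀) = b := by
      by_contra! hb'
      obtain ⟨z₁, z₂, h⟩ := hnc w₀ hw₀
      exact h (apply_eq_apply_of_forall_ne hdiff hne hb' (ha w₀ hw₀) z₁ z₂)
    exact eventually_mem_range_of_analyticOnNhd hD hf hw₀ (hnc w₀ hw₀) z₀
  filter_upwards [nhdsWithin_le_nhds hball, self_mem_nhdsWithin] with w hw hwD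
  by_contra! hle
  obtain ⟨z, hz⟩ := hw (a w) (mem_closedBall_zero_iff.2 hle)
  exact ha w hwD z hz
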